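/- Let ϑ̄ ∈ C([0,1])ⁿ and let K > 0 satisfy K < c_p^{-2} = π²/4. Then there exists γ* = γ*(ϑ̄, K) such that for every γ > γ* and every fixed α ∈ C([0,1]) there is a unique solution (h,ϑ,λ) ∈ D × H^1_{0L}(I)ⁿ × H^1_{0L}(I)ⁿ of the reduced system: for each i = 1,…,n, −ϑ_i'' − h_i·Dm(α+ϑ_i) = 0 with ϑ_i(0)=ϑ_i'(1)=0; −λ_i'' − λ_i h_i·D²m(α+ϑ_i) = ϑ_i − ϑ̄_i with λ_i(0)=λ_i'(1)=0; and h_i = −(1/γ)∫₀¹ λ_i Dm(α+ϑ_i). -/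

import Mathlib

open MeasureTheory Set

noncomputable def edot (p q : ℝ × ℝ) : ℝ := p.1 * q.1 + p.2 * q.2
noncomputable def enorm2 (p : ℝ × ℝ) : ℝ := Real.sqrt (p.1 ^ 2 + p.2 ^ 2)
noncomputable def Dmvec (v : ℝ) : ℝ × ℝ := (-Real.sin v, Real.cos v)
noncomputable def D2mvec (v : ℝ) : ℝ × ℝ := (-Real.cos v, -Real.sin v)

noncomputable def mu01 : Measure ℝ := volume.restrict (Ioo 0 1)

/-- `H^1_{0L}(I)` modelled isometrically by the `L²(I)` space of derivatives. -/
noncomputable abbrev E := Lp ℝ 2 mu01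

noncomputable def U (g : E) : ℝ → ℝ := fun t => ∫ s in Ioc 0 t, (g : ℝ → ℝ) s ∂mu01

/-- Weak solution of the state equation `(P_ϑ)` with design the raw function `α`. -/
def IsStateSolF (α : ℝ → ℝ) (p : ℝ × ℝ) (g : E) : Prop :=
  ∀ w : E, (∫ s, (g : ℝ → ℝ) s * (w : ℝ → ℝ) s ∂mu01)
    - (∫ s, edot p (Dmvec (α s + U g s)) * U w s ∂mu01) = 0

/-- Weak solution of the adjoint equation `(P_λ)`. -/
def IsAdjSolF (α : ℝ → ℝ) (p : ℝ × ℝ) (g : E) (tbi : ℝ → ℝ) (l : E) : Prop :=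
  ∀ w : E, (∫ s, (l : ℝ → ℝ) s * (w : ℝ → ℝ) s ∂mu01)
    - (∫ s, U l s * edot p (D2mvec (α s + U g s)) * U w s ∂mu01)
    = ∫ s, (U g s - tbi s) * U w s ∂mu01

/-- The value `T_i^{(α)}(h) = −(1/γ)∫₀¹ λᵢ Dm(α+ϑᵢ)` of the chain map. -/
noncomputable def Tval (γ : ℝ) (α : ℝ → ℝ) (g l : E) : ℝ × ℝ :=
  (-(1 / γ) * ∫ s, U l s * (Dmvec (α s + U g s)).1 ∂mu01,
   -(1 / γ) * ∫ s, U l s * (Dmvec (α s + U g s)).2 ∂mu01)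

instance : IsProbabilityMeasure mu01 :=
  ⟨by simp [mu01]⟩

lemma integrable_coe (g : E) : Integrable (g : ℝ → ℝ) mu01 :=
  (Lp.memLp g).integrable (by norm_num)

lemma U_add (f g : E) (t : ℝ) : U (f + g) t = U f t + U g t := by
  unfold U
  rw [← integral_add (integrable_coe f).restrict (integrable_coe g).restrict]
  exact integral_congr_ae (ae_restrict_of_ae (Lp.coeFn_add f g))

lemma U_smul (c : ℝ) (g : E) (t : ℝ) : U (c • g) t = c * U g t := by
  unfold U
  rw [← integral_const_mul]
  exact integral_congr_ae (ae_restrict_of_ae (Lp.coeFn_smul c g))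

lemma U_sub (f g : E) (t : ℝ) : U (f - g) t = U f t - U g t := by
  have h := U_add (f - g) g t
  rw [sub_add_cancel] at h
  linarith

lemma U_zero (t : ℝ) : U 0 t = 0 := by
  simpa using U_smul 0 0 t

lemma enorm_U_le (g : E) (t : ℝ) : ‖U g t‖ₑ ≤ ∫⁻ s in Ioc 0 t, ‖(g : ℝ → ℝ) s‖ₑ ∂mu01 :=
  enorm_integral_le_lintegral_enorm _

lemma abs_U_le (g : E) (t : ℝ) : |U g t| ≤ ‖g‖ := by
  have h : ‖U g t‖ₑ ≤ ‖g‖ₑ := calc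
    ‖U g t‖ₑ ≤ ∫⁻ s in Ioc 0 t, ‖(g : ℝ → ℝ) s‖ₑ ∂mu01 := enorm_U_le g t
    _ ≤ ∫⁻ s, ‖(g : ℝ → ℝ) s‖ₑ ∂mu01 := setLIntegral_le_lintegral _ _
    _ = eLpNorm g 1 mu01 := eLpNorm_one_eq_lintegral_enorm.symm
    _ ≤ eLpNorm g 2 mu01 :=
        eLpNorm_le_eLpNorm_of_exponent_le (by norm_num) (Lp.aestronglyMeasurable g)
    _ = ‖g‖ₑ := (Lp.enorm_def g).symm
  have := (ENNReal.toReal_le_toReal (by simp) (by simp)).2 h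
  simpa using this

lemma aestronglyMeasurable_U (g : E) : AEStronglyMeasurable (U g) mu01 := by
  have hc : Continuous fun t => ∫ s in (0:ℝ)..t, (g : ℝ → ℝ) s ∂mu01 :=
    haveI : NullSingletonClass mu01 := by unfold mu01; infer_instance
    intervalIntegral.continuous_primitive (fun a b => (integrable_coe g).intervalIntegrable) 0
  refine hc.aestronglyMeasurable.congr ?_
  filter_upwards [ae_restrict_mem (measurableSet_Ioo (a := (0:ℝ)) (b := 1))] with t ht
  exact intervalIntegral.integral_of_le ht.1.le

lemma memLp_U (g : E) : MemLp (U g) 2 mu01 :=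
  MemLp.of_bound (aestronglyMeasurable_U g) ‖g‖ (.of_forall (abs_U_le g))

lemma sq_lintegral_mul_le {f g : ℝ → ENNReal} {μ : Measure ℝ} (hf : AEMeasurable f μ)
    (hg : AEMeasurable g μ) :
    (∫⁻ s, f s * g s ∂μ) ^ 2 ≤ (∫⁻ s, f s ^ 2 ∂μ) * ∫⁻ s, g s ^ 2 ∂μ := by
  have h := ENNReal.lintegral_mul_le_Lp_mul_Lq μ Real.HolderConjugate.two_two hf hg
  have h2 := pow_le_pow_left' h 2
  rw [mul_pow, ← ENNReal.rpow_mul_natCast, ← ENNReal.rpow_mul_natCast] at h2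
  simpa using h2

lemma lintegral_cos_le {t : ℝ} (h0 : 0 < t) (h1 : t < 1) :
    ∫⁻ s in Ioc 0 t, ENNReal.ofReal (Real.cos (Real.pi / 2 * s)) ∂mu01
      ≤ ENNReal.ofReal (2 / Real.pi * Real.sin (Real.pi / 2 * t)) := by
  have hp := Real.pi_pos
  calc _ ≤ ∫⁻ s in Ioc 0 t, ENNReal.ofReal (Real.cos (Real.pi / 2 * s)) :=
        lintegral_mono' (Measure.restrict_mono le_rfl Measure.restrict_le_self) le_rfl
    _ = ENNReal.ofReal (∫ s in Ioc 0 t, Real.cos (Real.pi / 2 * s)) := by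
        refine (ofReal_integral_eq_lintegral_ofReal ?_ ?_).symm
        · exact (Continuous.integrableOn_Icc (by fun_prop)).mono_set Ioc_subset_Icc_self
        · filter_upwards [ae_restrict_mem measurableSet_Ioc] with s hs
          exact Real.cos_nonneg_of_mem_Icc ⟨by nlinarith [hs.1], by nlinarith [hs.2]⟩
    _ = _ := by
        rw [← intervalIntegral.integral_of_le h0.le,
          intervalIntegral.integral_comp_mul_left _ (by positivity), integral_cos]
        simp

lemma lintegral_sin_le {s : ℝ} (h0 : 0 < s) (h1 : s < 1) :
    ∫⁻ t in Ici s, ENNReal.ofReal (2 / Real.pi * Real.sin (Real.pi / 2 * t)) ∂mu01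
      ≤ ENNReal.ofReal ((2 / Real.pi) ^ 2) * ENNReal.ofReal (Real.cos (Real.pi / 2 * s)) := by
  have hp := Real.pi_pos
  calc _ ≤ ∫⁻ t in Icc s 1, ENNReal.ofReal (2 / Real.pi * Real.sin (Real.pi / 2 * t)) := by
        refine lintegral_mono' ?_ le_rfl
        rw [mu01, Measure.restrict_restrict measurableSet_Ici]
        have hsub : Ici s ∩ Ioo 0 1 ⊆ Icc s 1 := fun x hx => ⟨hx.1, hx.2.2.le⟩
        exact Measure.restrict_mono hsub le_rfl
    _ = ENNReal.ofReal (∫ t in Icc s 1, 2 / Real.pi * Real.sin (Real.pi / 2 * t)) := by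
        refine (ofReal_integral_eq_lintegral_ofReal ?_ ?_).symm
        · exact (Continuous.integrableOn_Icc (by fun_prop))
        · filter_upwards [ae_restrict_mem measurableSet_Icc] with t ht
          refine mul_nonneg (by positivity) ?_
          exact Real.sin_nonneg_of_mem_Icc ⟨by nlinarith [ht.1], by nlinarith [ht.2]⟩
    _ = _ := by
        rw [← ENNReal.ofReal_mul (by positivity), integral_Icc_eq_integral_Ioc,
          ← intervalIntegral.integral_of_le h1.le, intervalIntegral.integral_const_mul,
          intervalIntegral.integral_comp_mul_left _ (by positivity), integral_sin]
        simp
        ring_nf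

/-- The Poincaré inequality on `H^1_{0L}(I)` with the sharp constant `2 / π`. -/
lemma lintegral_sq_U_le (g : E) :
    ∫⁻ t, ‖U g t‖ₑ ^ 2 ∂mu01
      ≤ ENNReal.ofReal ((2 / Real.pi) ^ 2) * ∫⁻ s, ‖(g : ℝ → ℝ) s‖ₑ ^ 2 ∂mu01 := by
  have hp := Real.pi_pos
  set a : ℝ → ENNReal := fun s => ENNReal.ofReal (Real.cos (Real.pi / 2 * s)) with ha
  set b : ℝ → ENNReal := fun t =>
    ENNReal.ofReal (2 / Real.pi * Real.sin (Real.pi / 2 * t)) with hb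
  have ham : Measurable a := by fun_prop
  have hbm : Measurable b := by fun_prop
  have hgm : AEMeasurable (fun s => ‖(g : ℝ → ℝ) s‖ₑ) mu01 :=
    (Lp.aestronglyMeasurable g).enorm
  have hmem : ∀ᵐ s ∂mu01, s ∈ Ioo (0:ℝ) 1 := ae_restrict_mem measurableSet_Ioo
  have hapos : ∀ s ∈ Ioo (0:ℝ) 1, a s ≠ 0 := fun s hs => by
    rw [ha]
    simp only [ne_eq, ENNReal.ofReal_eq_zero, not_le]
    exact Real.cos_pos_of_mem_Ioo ⟨by nlinarith [hs.1], by nlinarith [hs.2]⟩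
  have hatop : ∀ s, a s ≠ ⊤ := fun s => ENNReal.ofReal_ne_top
  set G : ℝ → ENNReal := fun s => ‖(g : ℝ → ℝ) s‖ₑ ^ 2 * (a s)⁻¹ with hG
  have hGm : AEMeasurable G mu01 := (hgm.pow_const 2).mul ham.inv.aemeasurable
  have hpt : ∀ t ∈ Ioo (0:ℝ) 1, ‖U g t‖ₑ ^ 2 ≤ b t * ∫⁻ s in Ioc 0 t, G s ∂mu01 := by
    intro t ht
    calc ‖U g t‖ₑ ^ 2 ≤ (∫⁻ s in Ioc 0 t, ‖(g : ℝ → ℝ) s‖ₑ ∂mu01) ^ 2 := by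
          gcongr; exact enorm_U_le g t
      _ = (∫⁻ s in Ioc 0 t, (‖(g : ℝ → ℝ) s‖ₑ * (a s ^ (1 / 2 : ℝ))⁻¹) *
            a s ^ (1 / 2 : ℝ) ∂mu01) ^ 2 := by
          congr 1
          refine lintegral_congr_ae (ae_restrict_of_ae ?_)
          filter_upwards [hmem] with s hs
          rw [mul_assoc, ENNReal.inv_mul_cancel, mul_one]
          · simp [ENNReal.rpow_eq_zero_iff, hapos s hs]
          · exact ENNReal.rpow_ne_top_of_nonneg (by norm_num) (hatop s)
      _ ≤ (∫⁻ s in Ioc 0 t, (‖(g : ℝ → ℝ) s‖ₑ * (a s ^ (1 / 2 : ℝ))⁻¹) ^ 2 ∂mu01) *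
            ∫⁻ s in Ioc 0 t, (a s ^ (1 / 2 : ℝ)) ^ 2 ∂mu01 := by
          refine sq_lintegral_mul_le ?_ ?_
          · exact hgm.restrict.mul (ham.pow_const _).inv.aemeasurable
          · exact (ham.pow_const _).aemeasurable
      _ = (∫⁻ s in Ioc 0 t, G s ∂mu01) * ∫⁻ s in Ioc 0 t, a s ∂mu01 := by
          have h2 : ∀ s, (a s ^ (1 / 2 : ℝ)) ^ 2 = a s := fun s => by
            rw [← ENNReal.rpow_mul_natCast]; norm_num
          simp_rw [mul_pow, ← ENNReal.inv_pow, h2, hG]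
      _ ≤ b t * ∫⁻ s in Ioc 0 t, G s ∂mu01 := by
          rw [mul_comm]; gcongr; exact lintegral_cos_le ht.1 ht.2
  calc ∫⁻ t, ‖U g t‖ₑ ^ 2 ∂mu01
      ≤ ∫⁻ t, ∫⁻ s, (if s ≤ t then b t * G s else 0) ∂mu01 ∂mu01 := by
        refine lintegral_mono_ae ?_
        filter_upwards [hmem] with t ht
        refine (hpt t ht).trans ?_
        rw [← lintegral_const_mul' _ _ ENNReal.ofReal_ne_top,
          ← lintegral_indicator measurableSet_Ioc]
        refine lintegral_mono fun s => ?_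
        by_cases h : s ∈ Ioc 0 t
        · simp [h, h.2, hb]
        · simp [h]
    _ = ∫⁻ s, ∫⁻ t, (if s ≤ t then b t * G s else 0) ∂mu01 ∂mu01 := by
        refine lintegral_lintegral_swap ?_
        have h1 : AEMeasurable (fun p : ℝ × ℝ => b p.1 * G p.2) (mu01.prod mu01) :=
          (hbm.comp measurable_fst).aemeasurable.mul
            (hGm.comp_quasiMeasurePreserving Measure.quasiMeasurePreserving_snd)
        have h2 : MeasurableSet {p : ℝ × ℝ | p.2 ≤ p.1} :=
          measurableSet_le measurable_snd measurable_fst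
        refine (h1.indicator h2).congr (.of_forall fun p => ?_)
        simp [Set.indicator_apply, Function.uncurry]
    _ ≤ ∫⁻ s, ENNReal.ofReal ((2 / Real.pi) ^ 2) * ‖(g : ℝ → ℝ) s‖ₑ ^ 2 ∂mu01 := by
        refine lintegral_mono_ae ?_
        filter_upwards [hmem] with s hs
        calc ∫⁻ t, (if s ≤ t then b t * G s else 0) ∂mu01
            = (∫⁻ t in Ici s, b t ∂mu01) * G s := by
              rw [← lintegral_mul_const _ hbm, ← lintegral_indicator measurableSet_Ici]
              refine lintegral_congr fun t => ?_
              simp [Set.indicator_apply]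
          _ ≤ (ENNReal.ofReal ((2 / Real.pi) ^ 2) * a s) * G s := by
              gcongr; exact lintegral_sin_le hs.1 hs.2
          _ = ENNReal.ofReal ((2 / Real.pi) ^ 2) * ‖(g : ℝ → ℝ) s‖ₑ ^ 2 * (a s * (a s)⁻¹) := by
              rw [hG]; ring
          _ = _ := by rw [ENNReal.mul_inv_cancel (hapos s hs) (hatop s), mul_one]
    _ = _ := lintegral_const_mul' _ _ ENNReal.ofReal_ne_top

lemma norm_toLp_U_le (g : E) : ‖(memLp_U g).toLp (U g)‖ ≤ 2 / Real.pi * ‖g‖ := by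
  have hsq : ∀ f : ℝ → ℝ, ∫⁻ s, ‖f s‖ₑ ^ 2 ∂mu01 = eLpNorm f 2 mu01 ^ 2 := fun f => by
    simpa using (eLpNorm_nnreal_pow_eq_lintegral (f := f) (μ := mu01)
      (p := 2) (by norm_num)).symm
  have h := lintegral_sq_U_le g
  rw [hsq, hsq, ENNReal.ofReal_pow (by positivity), ← mul_pow] at h
  have h2 := (ENNReal.pow_le_pow_left_iff two_ne_zero).1 h
  rw [Lp.norm_toLp]
  refine ENNReal.toReal_le_of_le_ofReal (by positivity) (h2.trans_eq ?_)
  rw [ENNReal.ofReal_mul (by positivity), Lp.norm_def, ENNReal.ofReal_toReal (Lp.eLpNorm_ne_top g)]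

lemma integral_mul_eq_inner (f g : E) :
    ∫ s, (f : ℝ → ℝ) s * (g : ℝ → ℝ) s ∂mu01 = inner ℝ f g := by
  rw [L2.inner_def]
  exact integral_congr_ae (.of_forall fun s => by simp [mul_comm])

lemma memLp_abs_U (g : E) : MemLp (fun s => |U g s|) 2 mu01 := (memLp_U g).abs

lemma integral_abs_U_mul_le (f g : E) :
    ∫ s, |U f s| * |U g s| ∂mu01 ≤ (2 / Real.pi) ^ 2 * ‖f‖ * ‖g‖ := by
  have hF := memLp_abs_U f
  have hG := memLp_abs_U g
  have hn : ∀ f : E, ‖(memLp_abs_U f).toLp‖ ≤ 2 / Real.pi * ‖f‖ := fun f => by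
    refine le_trans (le_of_eq ?_) (norm_toLp_U_le f)
    rw [Lp.norm_toLp, Lp.norm_toLp]
    exact congrArg ENNReal.toReal (eLpNorm_norm (U f))
  calc ∫ s, |U f s| * |U g s| ∂mu01
      = ∫ s, (hF.toLp : ℝ → ℝ) s * (hG.toLp : ℝ → ℝ) s ∂mu01 := by
        refine integral_congr_ae ?_
        filter_upwards [hF.coeFn_toLp, hG.coeFn_toLp] with s h1 h2
        rw [h1, h2]
    _ = inner ℝ hF.toLp hG.toLp := integral_mul_eq_inner _ _
    _ ≤ ‖hF.toLp‖ * ‖hG.toLp‖ := real_inner_le_norm _ _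
    _ ≤ (2 / Real.pi * ‖f‖) * (2 / Real.pi * ‖g‖) :=
        mul_le_mul (hn f) (hn g) (norm_nonneg _) (by positivity)
    _ = _ := by ring

/-- `r` is the derivative of the weak solution of `-v'' = f`, `v(0) = v'(1) = 0`. -/
def IsPoissonSol (f : ℝ → ℝ) (r : E) : Prop :=
  ∀ w : E, ∫ s, (r : ℝ → ℝ) s * (w : ℝ → ℝ) s ∂mu01 = ∫ s, f s * U w s ∂mu01

lemma integrable_mul_U {f : ℝ → ℝ} (hf : MemLp f 2 mu01) (w : E) :
    Integrable (fun s => f s * U w s) mu01 :=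
  hf.integrable_mul (memLp_U w)

lemma exists_isPoissonSol {f : ℝ → ℝ} (hf : MemLp f 2 mu01) : ∃ r : E, IsPoissonSol f r := by
  let φ : E →ₗ[ℝ] ℝ :=
    { toFun := fun w => ∫ s, f s * U w s ∂mu01
      map_add' := fun v w => by
        rw [← integral_add (integrable_mul_U hf v) (integrable_mul_U hf w)]
        simp_rw [U_add, mul_add]
      map_smul' := fun c w => by
        rw [RingHom.id_apply, smul_eq_mul, ← integral_const_mul]
        simp_rw [U_smul, mul_left_comm] }
  have hφ : ∀ w, ‖φ w‖ ≤ (∫ s, |f s| ∂mu01) * ‖w‖ := fun w => by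
    rw [← integral_mul_const]
    refine norm_integral_le_of_norm_le
      ((hf.integrable (by norm_num)).abs.mul_const _) (.of_forall fun s => ?_)
    rw [norm_mul]
    exact mul_le_mul_of_nonneg_left (abs_U_le w s) (abs_nonneg _)
  refine ⟨(InnerProductSpace.toDual ℝ E).symm (φ.mkContinuous _ hφ), fun w => ?_⟩
  rw [integral_mul_eq_inner, InnerProductSpace.toDual_symm_apply]
  rfl

lemma norm_sub_le_of_isPoissonSol {f f' : ℝ → ℝ} (hf : MemLp f 2 mu01) (hf' : MemLp f' 2 mu01)
    {r r' d : E} (hr : IsPoissonSol f r) (hr' : IsPoissonSol f' r') {K B : ℝ} (hB : 0 ≤ B)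
    (hK : 0 ≤ K) (h : ∀ᵐ s ∂mu01, |f s - f' s| ≤ K * |U d s| + B) :
    ‖r - r'‖ ≤ (2 / Real.pi) ^ 2 * K * ‖d‖ + B := by
  set w := r - r' with hw
  have hi : Integrable (fun s => K * (|U d s| * |U w s|)) mu01 :=
    ((memLp_abs_U d).integrable_mul (memLp_abs_U w)).const_mul K
  have key : ‖w‖ * ‖w‖ ≤ ((2 / Real.pi) ^ 2 * K * ‖d‖ + B) * ‖w‖ := by
    calc ‖w‖ * ‖w‖ = inner ℝ r w - inner ℝ r' w := by
          rw [← inner_sub_left, ← hw, real_inner_self_eq_norm_mul_norm]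
      _ = ∫ s, (f s - f' s) * U w s ∂mu01 := by
          rw [← integral_mul_eq_inner, ← integral_mul_eq_inner, hr, hr',
            ← integral_sub (integrable_mul_U hf w) (integrable_mul_U hf' w)]
          simp_rw [sub_mul]
      _ ≤ ∫ s, (K * (|U d s| * |U w s|) + B * ‖w‖) ∂mu01 := by
          refine integral_mono_ae (integrable_mul_U (hf.sub hf') w) (hi.add (integrable_const _)) ?_
          filter_upwards [h] with s hs
          calc (f s - f' s) * U w s ≤ |f s - f' s| * |U w s| := by
                rw [← abs_mul]; exact le_abs_self _
            _ ≤ (K * |U d s| + B) * |U w s| := by gcongr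
            _ = K * (|U d s| * |U w s|) + B * |U w s| := by ring
            _ ≤ _ := by gcongr; exact abs_U_le w s
      _ = K * (∫ s, |U d s| * |U w s| ∂mu01) + B * ‖w‖ := by
          rw [integral_add hi (integrable_const _), integral_const_mul, integral_const]
          simp
      _ ≤ K * ((2 / Real.pi) ^ 2 * ‖d‖ * ‖w‖) + B * ‖w‖ := by
          gcongr; exact integral_abs_U_mul_le d w
      _ = _ := by ring
  rcases (norm_nonneg w).eq_or_lt with h0 | h0
  · rw [← h0]; positivity
  · exact le_of_mul_le_mul_right key h0

lemma isPoissonSol_zero : IsPoissonSol (fun _ => 0) 0 := fun w => by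
  rw [integral_mul_eq_inner]; simp

lemma edot_sub_left (p p' q : ℝ × ℝ) : edot p q - edot p' q = edot (p - p') q := by
  simp [edot]; ring

lemma edot_sub_right (p q q' : ℝ × ℝ) : edot p q - edot p q' = edot p (q - q') := by
  simp [edot]; ring

lemma abs_edot_le (p q : ℝ × ℝ) : |edot p q| ≤ enorm2 p * enorm2 q := by
  rw [enorm2, enorm2, ← Real.sqrt_mul (by positivity)]
  refine Real.abs_le_sqrt ?_
  simp only [edot]
  nlinarith [sq_nonneg (p.1 * q.2 - p.2 * q.1)]

lemma enorm2_le (p : ℝ × ℝ) : enorm2 p ≤ 2 * ‖p‖ := by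
  have h1 : |p.1| ≤ ‖p‖ := norm_fst_le p
  have h2 : |p.2| ≤ ‖p‖ := norm_snd_le p
  refine Real.sqrt_le_iff.2 ⟨by positivity, ?_⟩
  rw [← sq_abs p.1, ← sq_abs p.2]
  nlinarith [abs_nonneg p.1, abs_nonneg p.2]

lemma enorm2_Dmvec (x : ℝ) : enorm2 (Dmvec x) = 1 := by
  simp [enorm2, Dmvec]

lemma enorm2_Dmvec_sub_le (x y : ℝ) : enorm2 (Dmvec x - Dmvec y) ≤ |x - y| := by
  refine Real.sqrt_le_iff.2 ⟨abs_nonneg _, ?_⟩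
  have := Real.one_sub_sq_div_two_le_cos (x := x - y)
  rw [Real.cos_sub] at this
  rw [sq_abs]
  simp only [Dmvec, Prod.fst_sub, Prod.snd_sub]
  nlinarith [Real.sin_sq_add_cos_sq x, Real.sin_sq_add_cos_sq y]

lemma D2mvec_eq (x : ℝ) : D2mvec x = Dmvec (x + Real.pi / 2) := by
  simp [D2mvec, Dmvec, Real.sin_add_pi_div_two, Real.cos_add_pi_div_two]

lemma abs_edot_Dmvec_le (p : ℝ × ℝ) (x : ℝ) : |edot p (Dmvec x)| ≤ enorm2 p := by
  simpa [enorm2_Dmvec] using abs_edot_le p (Dmvec x)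

lemma abs_edot_Dmvec_sub_le (p p' : ℝ × ℝ) (x y : ℝ) :
    |edot p (Dmvec x) - edot p' (Dmvec y)| ≤ enorm2 p * |x - y| + 2 * ‖p - p'‖ := by
  calc |edot p (Dmvec x) - edot p' (Dmvec y)|
      = |edot p (Dmvec x - Dmvec y) + edot (p - p') (Dmvec y)| := by
        rw [← edot_sub_left, ← edot_sub_right]; ring_nf
    _ ≤ |edot p (Dmvec x - Dmvec y)| + |edot (p - p') (Dmvec y)| := abs_add_le _ _
    _ ≤ enorm2 p * |x - y| + 2 * ‖p - p'‖ :=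
        add_le_add ((abs_edot_le _ _).trans
          (mul_le_mul_of_nonneg_left (enorm2_Dmvec_sub_le x y) (Real.sqrt_nonneg _)))
          ((abs_edot_Dmvec_le _ _).trans (enorm2_le _))

lemma abs_edot_D2mvec_le (p : ℝ × ℝ) (x : ℝ) : |edot p (D2mvec x)| ≤ enorm2 p := by
  rw [D2mvec_eq]; exact abs_edot_Dmvec_le _ _

lemma abs_edot_D2mvec_sub_le (p p' : ℝ × ℝ) (x y : ℝ) :
    |edot p (D2mvec x) - edot p' (D2mvec y)| ≤ enorm2 p * |x - y| + 2 * ‖p - p'‖ := by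
  simpa [D2mvec_eq] using abs_edot_Dmvec_sub_le p p' (x + Real.pi / 2) (y + Real.pi / 2)

lemma abs_mul_sub_mul_le {a b a' b' : ℝ} (ha : |a| ≤ 1) :
    |b * a - b' * a'| ≤ |b - b'| + |b'| * |a - a'| := by
  calc |b * a - b' * a'| = |(b - b') * a + b' * (a - a')| := by ring_nf
    _ ≤ |b - b'| * |a| + |b'| * |a - a'| := by
        rw [← abs_mul, ← abs_mul]; exact abs_add_le _ _
    _ ≤ _ := by gcongr; exact mul_le_of_le_one_right (abs_nonneg _) ha

lemma exists_isPoissonSol_self {F : E → ℝ → ℝ} {K : ℝ} (hK : 0 ≤ K)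
    (hκ : (2 / Real.pi) ^ 2 * K < 1) (hF : ∀ g, MemLp (F g) 2 mu01)
    (hFK : ∀ g g', ∀ᵐ s ∂mu01, |F g s - F g' s| ≤ K * |U (g - g') s|) :
    ∃ g, IsPoissonSol (F g) g := by
  choose R hR using fun g => exists_isPoissonSol (hF g)
  have hκ0 : 0 ≤ (2 / Real.pi) ^ 2 * K := by positivity
  have hc : ContractingWith ⟨_, hκ0⟩ R := by
    refine ⟨NNReal.coe_lt_coe.1 hκ, LipschitzWith.of_dist_le_mul fun g g' => ?_⟩
    rw [dist_eq_norm, dist_eq_norm]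
    have h := norm_sub_le_of_isPoissonSol (hF g) (hF g') (hR g) (hR g') le_rfl hK
      (by simpa using hFK g g')
    rwa [add_zero] at h
  have hfix : R (hc.fixedPoint R) = hc.fixedPoint R := hc.fixedPoint_isFixedPt
  refine ⟨hc.fixedPoint R, ?_⟩
  have h := hR (hc.fixedPoint R)
  rwa [hfix] at h

/-- The right-hand side of the state equation. -/
noncomputable def stateRhs (α : ℝ → ℝ) (p : ℝ × ℝ) (g : E) (s : ℝ) : ℝ :=
  edot p (Dmvec (α s + U g s))

/-- The right-hand side of the adjoint equation. -/
noncomputable def adjRhs (α : ℝ → ℝ) (p : ℝ × ℝ) (g : E) (τ : ℝ → ℝ) (l : E) (s : ℝ) : ℝ :=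
  U l s * edot p (D2mvec (α s + U g s)) + (U g s - τ s)

lemma memLp_of_continuous_comp {α τ f : ℝ → ℝ} (hα : AEStronglyMeasurable α mu01)
    (hτ : AEStronglyMeasurable τ mu01) (hf : Continuous f) {B : ℝ} (hB : ∀ x, |f x| ≤ B) :
    MemLp (fun s => f (α s + τ s)) 2 mu01 :=
  MemLp.of_bound (hf.comp_aestronglyMeasurable (hα.add hτ)) B (.of_forall fun _ => hB _)

lemma memLp_stateRhs {α : ℝ → ℝ} (hα : AEStronglyMeasurable α mu01) (p : ℝ × ℝ) (g : E) :
    MemLp (stateRhs α p g) 2 mu01 :=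
  memLp_of_continuous_comp hα (aestronglyMeasurable_U g) (f := fun x => edot p (Dmvec x))
    (by unfold edot Dmvec; fun_prop) (abs_edot_Dmvec_le p)

lemma memLp_U_mul_edot_D2mvec {α : ℝ → ℝ} (hα : AEStronglyMeasurable α mu01)
    (p : ℝ × ℝ) (g l : E) :
    MemLp (fun s => U l s * edot p (D2mvec (α s + U g s))) 2 mu01 := by
  have h := memLp_of_continuous_comp hα (aestronglyMeasurable_U g)
    (f := fun x => edot p (D2mvec x)) (by unfold edot D2mvec; fun_prop) (abs_edot_D2mvec_le p)
  refine MemLp.of_bound ((aestronglyMeasurable_U l).mul h.1) (‖l‖ * enorm2 p)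
    (.of_forall fun s => ?_)
  rw [norm_mul]
  exact mul_le_mul (abs_U_le l s) (abs_edot_D2mvec_le _ _) (abs_nonneg _) (norm_nonneg _)

lemma memLp_adjRhs {α τ : ℝ → ℝ} (hα : AEStronglyMeasurable α mu01) (hτ : MemLp τ 2 mu01)
    (p : ℝ × ℝ) (g l : E) : MemLp (adjRhs α p g τ l) 2 mu01 :=
  (memLp_U_mul_edot_D2mvec hα p g l).add ((memLp_U g).sub hτ)

lemma isStateSolF_iff {α : ℝ → ℝ} {p : ℝ × ℝ} {g : E} :
    IsStateSolF α p g ↔ IsPoissonSol (stateRhs α p g) g :=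
  forall_congr' fun _ => sub_eq_zero

lemma isAdjSolF_iff {α τ : ℝ → ℝ} (hα : AEStronglyMeasurable α mu01) (hτ : MemLp τ 2 mu01)
    {p : ℝ × ℝ} {g l : E} :
    IsAdjSolF α p g τ l ↔ IsPoissonSol (adjRhs α p g τ l) l := by
  refine forall_congr' fun w => ?_
  have h : Integrable (fun s => (U g s - τ s) * U w s) mu01 :=
    integrable_mul_U ((memLp_U g).sub hτ) w
  simp only [adjRhs, add_mul]
  rw [integral_add (integrable_mul_U (memLp_U_mul_edot_D2mvec hα p g l) w) h,
    sub_eq_iff_eq_add']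

lemma exists_isStateSolF {α : ℝ → ℝ} (hα : AEStronglyMeasurable α mu01) {K : ℝ}
    (hκ : (2 / Real.pi) ^ 2 * K < 1) {p : ℝ × ℝ} (hp : enorm2 p ≤ K) :
    ∃ g, IsStateSolF α p g := by
  simp_rw [isStateSolF_iff]
  refine exists_isPoissonSol_self ((Real.sqrt_nonneg _).trans hp) hκ (memLp_stateRhs hα p)
    fun g g' => .of_forall fun s => ?_
  have h := abs_edot_Dmvec_sub_le p p (α s + U g s) (α s + U g' s)
  rw [add_sub_add_left_eq_sub, ← U_sub, sub_self, norm_zero, mul_zero, add_zero] at h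
  exact h.trans (by gcongr)

lemma exists_isAdjSolF {α τ : ℝ → ℝ} (hα : AEStronglyMeasurable α mu01)
    (hτ : MemLp τ 2 mu01) {K : ℝ} (hκ : (2 / Real.pi) ^ 2 * K < 1) {p : ℝ × ℝ}
    (hp : enorm2 p ≤ K) (g : E) : ∃ l, IsAdjSolF α p g τ l := by
  simp_rw [isAdjSolF_iff hα hτ]
  refine exists_isPoissonSol_self ((Real.sqrt_nonneg _).trans hp) hκ (memLp_adjRhs hα hτ p g)
    fun l l' => .of_forall fun s => ?_
  rw [adjRhs, adjRhs, add_sub_add_right_eq_sub, ← sub_mul, ← U_sub, abs_mul, mul_comm]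
  gcongr
  exact (abs_edot_D2mvec_le _ _).trans hp

lemma norm_le_of_isStateSolF {α : ℝ → ℝ} (hα : AEStronglyMeasurable α mu01) {K : ℝ}
    {p : ℝ × ℝ} (hp : enorm2 p ≤ K) {g : E} (hg : IsStateSolF α p g) : ‖g‖ ≤ K := by
  have h := norm_sub_le_of_isPoissonSol (d := 0) (K := 0) (memLp_stateRhs hα p g)
    (memLp_const 0) (isStateSolF_iff.1 hg) isPoissonSol_zero ((Real.sqrt_nonneg _).trans hp)
    le_rfl (.of_forall fun s => by
      simpa [stateRhs] using (abs_edot_Dmvec_le p (α s + U g s)).trans hp)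
  simpa using h

lemma norm_le_of_isAdjSolF {α τ : ℝ → ℝ} (hα : AEStronglyMeasurable α mu01)
    (hτ : AEStronglyMeasurable τ mu01) {K M : ℝ} (hM : ∀ᵐ s ∂mu01, |τ s| ≤ M) (hM0 : 0 ≤ M)
    (hκ : (2 / Real.pi) ^ 2 * K < 1) {p : ℝ × ℝ} (hp : enorm2 p ≤ K) {g l : E}
    (hg : IsStateSolF α p g) (hl : IsAdjSolF α p g τ l) :
    ‖l‖ ≤ (K + M) / (1 - (2 / Real.pi) ^ 2 * K) := by
  have hτ2 : MemLp τ 2 mu01 := MemLp.of_bound hτ M hM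
  have hK := (Real.sqrt_nonneg _).trans hp
  have hgK := norm_le_of_isStateSolF hα hp hg
  have h := norm_sub_le_of_isPoissonSol (d := l) (memLp_adjRhs hα hτ2 p g l)
    (memLp_const 0) ((isAdjSolF_iff hα hτ2).1 hl) isPoissonSol_zero (add_nonneg hK hM0) hK <| by
      filter_upwards [hM] with s hs
      have h1 : |U l s * edot p (D2mvec (α s + U g s))| ≤ K * |U l s| := by
        rw [abs_mul, mul_comm]
        gcongr
        exact (abs_edot_D2mvec_le _ _).trans hp
      have h2 : |U g s - τ s| ≤ K + M :=
        (abs_sub _ _).trans (add_le_add ((abs_U_le g s).trans hgK) hs)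
      rw [sub_zero]
      exact (abs_add_le _ _).trans (add_le_add h1 h2)
  rw [sub_zero] at h
  rw [le_div_iff₀ (by linarith)]
  linarith

lemma norm_sub_le_of_isStateSolF {α : ℝ → ℝ} (hα : AEStronglyMeasurable α mu01) {K : ℝ}
    (hκ : (2 / Real.pi) ^ 2 * K < 1) {p p' : ℝ × ℝ} (hp : enorm2 p ≤ K) {g g' : E}
    (hg : IsStateSolF α p g) (hg' : IsStateSolF α p' g') :
    ‖g - g'‖ ≤ 2 / (1 - (2 / Real.pi) ^ 2 * K) * ‖p - p'‖ := by
  have h := norm_sub_le_of_isPoissonSol (d := g - g') (K := K) (B := 2 * ‖p - p'‖)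
    (memLp_stateRhs hα p g) (memLp_stateRhs hα p' g') (isStateSolF_iff.1 hg)
    (isStateSolF_iff.1 hg') (by positivity) ((Real.sqrt_nonneg _).trans hp)
    (.of_forall fun s => by
      have h := abs_edot_Dmvec_sub_le p p' (α s + U g s) (α s + U g' s)
      rw [add_sub_add_left_eq_sub, ← U_sub] at h
      exact h.trans (by gcongr))
  rw [div_mul_eq_mul_div, le_div_iff₀ (by linarith)]
  linarith

lemma norm_sub_le_of_isAdjSolF {α τ : ℝ → ℝ} (hα : AEStronglyMeasurable α mu01)
    (hτ : MemLp τ 2 mu01) {K Λ : ℝ} (hκ : (2 / Real.pi) ^ 2 * K < 1) {p p' : ℝ × ℝ}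
    (hp : enorm2 p ≤ K) {g g' l l' : E} (hl : IsAdjSolF α p g τ l)
    (hl' : IsAdjSolF α p' g' τ l') (hΛ : ‖l'‖ ≤ Λ) :
    ‖l - l'‖ ≤ (Λ * (K * ‖g - g'‖ + 2 * ‖p - p'‖) + ‖g - g'‖)
      / (1 - (2 / Real.pi) ^ 2 * K) := by
  have hK := (Real.sqrt_nonneg _).trans hp
  have hΛ0 := (norm_nonneg _).trans hΛ
  have h := norm_sub_le_of_isPoissonSol (d := l - l') (K := K)
    (B := Λ * (K * ‖g - g'‖ + 2 * ‖p - p'‖) + ‖g - g'‖)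
    (memLp_adjRhs hα hτ p g l) (memLp_adjRhs hα hτ p' g' l') ((isAdjSolF_iff hα hτ).1 hl)
    ((isAdjSolF_iff hα hτ).1 hl') (by positivity) hK
    (.of_forall fun s => by
      set x := edot p (D2mvec (α s + U g s)) with hx
      set x' := edot p' (D2mvec (α s + U g' s)) with hx'
      have h1 : |x * U (l - l') s| ≤ K * |U (l - l') s| := by
        rw [abs_mul]
        gcongr
        exact (abs_edot_D2mvec_le _ _).trans hp
      have h2 : |x - x'| ≤ K * ‖g - g'‖ + 2 * ‖p - p'‖ := by
        have h := abs_edot_D2mvec_sub_le p p' (α s + U g s) (α s + U g' s)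
        rw [add_sub_add_left_eq_sub, ← U_sub] at h
        refine h.trans ?_
        gcongr
        exact abs_U_le _ _
      have h3 : |U l' s * (x - x')| ≤ Λ * (K * ‖g - g'‖ + 2 * ‖p - p'‖) := by
        rw [abs_mul]
        exact mul_le_mul ((abs_U_le _ _).trans hΛ) h2 (abs_nonneg _) hΛ0
      have h4 := abs_U_le (g - g') s
      calc |adjRhs α p g τ l s - adjRhs α p' g' τ l' s|
          = |x * U (l - l') s + (U l' s * (x - x') + U (g - g') s)| := by
            rw [adjRhs, adjRhs, U_sub, U_sub, ← hx, ← hx']; ring_nf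
        _ ≤ |x * U (l - l') s| + (|U l' s * (x - x')| + |U (g - g') s|) :=
            (abs_add_le _ _).trans (add_le_add_right (abs_add_le _ _) _)
        _ ≤ _ := add_le_add h1 (add_le_add h3 h4))
  rw [le_div_iff₀ (by linarith)]
  linarith

lemma abs_integral_sub_le {α f : ℝ → ℝ} (hα : AEStronglyMeasurable α mu01)
    (hf : Continuous f) (hf1 : ∀ x, |f x| ≤ 1) (hfl : ∀ x y, |f x - f y| ≤ |x - y|)
    (g g' l l' : E) :
    |(∫ s, U l s * f (α s + U g s) ∂mu01) - ∫ s, U l' s * f (α s + U g' s) ∂mu01|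
      ≤ ‖l - l'‖ + ‖l'‖ * ‖g - g'‖ := by
  have hi : ∀ g l : E, Integrable (fun s => U l s * f (α s + U g s)) mu01 := fun g l =>
    (memLp_U l).integrable_mul
      (memLp_of_continuous_comp hα (aestronglyMeasurable_U g) hf hf1)
  rw [← integral_sub (hi g l) (hi g' l')]
  have h := norm_integral_le_of_norm_le_const (μ := mu01) (C := ‖l - l'‖ + ‖l'‖ * ‖g - g'‖)
    (f := fun s => U l s * f (α s + U g s) - U l' s * f (α s + U g' s)) (.of_forall fun s => by
      refine (abs_mul_sub_mul_le (hf1 _)).trans ?_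
      have h := hfl (α s + U g s) (α s + U g' s)
      rw [add_sub_add_left_eq_sub, ← U_sub] at h
      rw [← U_sub]
      exact add_le_add (abs_U_le _ _) (mul_le_mul (abs_U_le _ _) (h.trans (abs_U_le _ _))
        (abs_nonneg _) (norm_nonneg _)))
  simpa using h

lemma abs_fst_le_enorm2 (p : ℝ × ℝ) : |p.1| ≤ enorm2 p :=
  Real.abs_le_sqrt (by nlinarith [sq_nonneg p.2])

lemma abs_snd_le_enorm2 (p : ℝ × ℝ) : |p.2| ≤ enorm2 p :=
  Real.abs_le_sqrt (by nlinarith [sq_nonneg p.1])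

lemma norm_Tval_sub_le {α : ℝ → ℝ} (hα : AEStronglyMeasurable α mu01) {γ : ℝ} (hγ : 0 < γ)
    (g g' l l' : E) :
    ‖Tval γ α g l - Tval γ α g' l'‖ ≤ (‖l - l'‖ + ‖l'‖ * ‖g - g'‖) / γ := by
  have h1 := abs_integral_sub_le (f := fun x => (Dmvec x).1) hα (by unfold Dmvec; fun_prop)
    (fun x => (abs_fst_le_enorm2 _).trans (enorm2_Dmvec x).le)
    (fun x y => (abs_fst_le_enorm2 _).trans (enorm2_Dmvec_sub_le x y)) g g' l l'
  have h2 := abs_integral_sub_le (f := fun x => (Dmvec x).2) hα (by unfold Dmvec; fun_prop)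
    (fun x => (abs_snd_le_enorm2 _).trans (enorm2_Dmvec x).le)
    (fun x y => (abs_snd_le_enorm2 _).trans (enorm2_Dmvec_sub_le x y)) g g' l l'
  have hs : ∀ {x y B : ℝ}, |x - y| ≤ B → ‖-(1 / γ) * x - -(1 / γ) * y‖ ≤ B / γ := by
    intro x y B h
    rw [← mul_sub, norm_mul, norm_neg, Real.norm_of_nonneg (by positivity), Real.norm_eq_abs,
      one_div_mul_eq_div]
    gcongr
  exact norm_prod_le_iff.2 ⟨hs h1, hs h2⟩

lemma Tval_zero_right (γ : ℝ) (α : ℝ → ℝ) (g : E) : Tval γ α g 0 = 0 := by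
  simp [Tval, U_zero]

lemma exists_unique_single {K M : ℝ} (hK : 0 < K) (hκ : (2 / Real.pi) ^ 2 * K < 1)
    (hM0 : 0 ≤ M) :
    ∃ γs : ℝ, 0 < γs ∧ ∀ γ : ℝ, γs < γ → ∀ α τ : ℝ → ℝ, AEStronglyMeasurable α mu01 →
      AEStronglyMeasurable τ mu01 → (∀ᵐ s ∂mu01, |τ s| ≤ M) →
      ∃ (p : ℝ × ℝ) (g l : E), enorm2 p ≤ K ∧ IsStateSolF α p g ∧ IsAdjSolF α p g τ l ∧
        p = Tval γ α g l ∧ ∀ (p' : ℝ × ℝ) (g' l' : E), enorm2 p' ≤ K → IsStateSolF α p' g' →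
          IsAdjSolF α p' g' τ l' → p' = Tval γ α g' l' → p' = p ∧ g' = g ∧ l' = l := by
  set q := 1 - (2 / Real.pi) ^ 2 * K with hq
  have hq0 : 0 < q := by linarith
  set Λ := (K + M) / q with hΛ
  have hΛ0 : 0 ≤ Λ := by positivity
  set G := 2 / q with hG
  set C := (Λ * (K * G + 2) + G) / q with hC
  have hC0 : 0 ≤ C := by positivity
  refine ⟨2 * Λ / K + (C + Λ * G) + 1, by positivity, fun γ hγ α τ hα hτ hM => ?_⟩
  have hγ1 : 2 * Λ / K < γ := by
    have : 0 ≤ C + Λ * G := by positivity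
    linarith
  have hγ2 : C + Λ * G < γ := by
    have : 0 ≤ 2 * Λ / K := by positivity
    linarith
  have hγ0 : 0 < γ := lt_of_le_of_lt (by positivity) hγ1
  have hτ2 : MemLp τ 2 mu01 := MemLp.of_bound hτ M hM
  have hgsub : ∀ {p p' : ℝ × ℝ} {g g' : E}, enorm2 p ≤ K → IsStateSolF α p g →
      IsStateSolF α p' g' → ‖g - g'‖ ≤ G * ‖p - p'‖ := fun hp hg hg' =>
    norm_sub_le_of_isStateSolF hα hκ hp hg hg'
  have hlsub : ∀ {p p' : ℝ × ℝ} {g g' l l' : E}, enorm2 p ≤ K → enorm2 p' ≤ K →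
      IsStateSolF α p g → IsStateSolF α p' g' → IsAdjSolF α p g τ l → IsAdjSolF α p' g' τ l' →
      ‖l - l'‖ ≤ C * ‖p - p'‖ := by
    intro p p' g g' l l' hp hp' hg hg' hl hl'
    refine (norm_sub_le_of_isAdjSolF (Λ := Λ) hα hτ2 hκ hp hl hl'
      (norm_le_of_isAdjSolF hα hτ hM hM0 hκ hp' hg' hl')).trans ?_
    rw [← hq, hC, div_mul_eq_mul_div (Λ * (K * G + 2) + G)]
    have h := hgsub hp hg hg'
    refine div_le_div_of_nonneg_right ?_ hq0.le
    calc Λ * (K * ‖g - g'‖ + 2 * ‖p - p'‖) + ‖g - g'‖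
        ≤ Λ * (K * (G * ‖p - p'‖) + 2 * ‖p - p'‖) + G * ‖p - p'‖ := by gcongr
      _ = _ := by ring
  have hTsub : ∀ {p p' : ℝ × ℝ} {g g' l l' : E}, enorm2 p ≤ K → enorm2 p' ≤ K →
      IsStateSolF α p g → IsStateSolF α p' g' → IsAdjSolF α p g τ l → IsAdjSolF α p' g' τ l' →
      ‖Tval γ α g l - Tval γ α g' l'‖ ≤ (C + Λ * G) / γ * ‖p - p'‖ := by
    intro p p' g g' l l' hp hp' hg hg' hl hl'
    refine (norm_Tval_sub_le hα hγ0 g g' l l').trans ?_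
    have h1 := hlsub hp hp' hg hg' hl hl'
    have h2 := hgsub hp hg hg'
    have h3 := norm_le_of_isAdjSolF hα hτ hM hM0 hκ hp' hg' hl'
    rw [div_mul_eq_mul_div]
    gcongr
    calc ‖l - l'‖ + ‖l'‖ * ‖g - g'‖ ≤ C * ‖p - p'‖ + Λ * (G * ‖p - p'‖) := by gcongr
      _ = _ := by ring
  have hex : ∀ p, ∃ g l, enorm2 p ≤ K → IsStateSolF α p g ∧ IsAdjSolF α p g τ l := by
    intro p
    by_cases hp : enorm2 p ≤ K
    · obtain ⟨g, hg⟩ := exists_isStateSolF hα hκ hp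
      obtain ⟨l, hl⟩ := exists_isAdjSolF hα hτ2 hκ hp g
      exact ⟨g, l, fun _ => ⟨hg, hl⟩⟩
    · exact ⟨0, 0, fun h => absurd h hp⟩
  choose g l hgl using hex
  have hD : IsClosed {p : ℝ × ℝ | enorm2 p ≤ K} :=
    isClosed_le (by unfold enorm2; fun_prop) continuous_const
  have hmaps : MapsTo (fun p => Tval γ α (g p) (l p)) {p | enorm2 p ≤ K}
      {p | enorm2 p ≤ K} := by
    intro p hp
    have h1 := norm_Tval_sub_le hα hγ0 (g p) (g p) (l p) 0
    have h2 := norm_le_of_isAdjSolF hα hτ hM hM0 hκ hp (hgl p hp).1 (hgl p hp).2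
    simp only [Tval_zero_right, sub_zero, norm_zero, zero_mul, add_zero] at h1
    rw [div_lt_iff₀ hK] at hγ1
    calc enorm2 (Tval γ α (g p) (l p)) ≤ 2 * ‖Tval γ α (g p) (l p)‖ := enorm2_le _
      _ ≤ 2 * (Λ / γ) := by gcongr; exact h1.trans (by gcongr)
      _ ≤ K := by rw [← mul_div_assoc, div_le_iff₀ hγ0]; linarith
  have hr0 : 0 ≤ (C + Λ * G) / γ := by positivity
  have hr1 : (C + Λ * G) / γ < 1 := (div_lt_one hγ0).2 hγ2
  have hcon : ContractingWith ⟨_, hr0⟩ (hmaps.restrict _ _ _) := by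
    refine ⟨NNReal.coe_lt_coe.1 hr1, LipschitzWith.of_dist_le_mul fun p p' => ?_⟩
    rw [Subtype.dist_eq, Subtype.dist_eq, dist_eq_norm, dist_eq_norm]
    exact hTsub p.2 p'.2 (hgl p p.2).1 (hgl p' p'.2).1 (hgl p p.2).2 (hgl p' p'.2).2
  have h0 : (0 : ℝ × ℝ) ∈ {p : ℝ × ℝ | enorm2 p ≤ K} := by simp [enorm2, hK.le]
  obtain ⟨p, hp, hfix, -⟩ :=
    hcon.exists_fixedPoint' hD.isComplete hmaps h0 (edist_ne_top _ _)
  have hfix' : Tval γ α (g p) (l p) = p := hfix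
  refine ⟨p, g p, l p, hp, (hgl p hp).1, (hgl p hp).2, hfix'.symm, ?_⟩
  intro p' g' l' hp' hg' hl' hT'
  have h := hTsub hp' hp hg' (hgl p hp).1 hl' (hgl p hp).2
  rw [← hT', hfix'] at h
  have hpp : ‖p' - p‖ = 0 := by nlinarith [norm_nonneg (p' - p)]
  have hgg := hgsub hp' hg' (hgl p hp).1
  have hll := hlsub hp' hp hg' (hgl p hp).1 hl' (hgl p hp).2
  rw [hpp, mul_zero] at hgg hll
  exact ⟨sub_eq_zero.1 (norm_eq_zero.1 hpp), sub_eq_zero.1 (norm_le_zero_iff.1 hgg),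
    sub_eq_zero.1 (norm_le_zero_iff.1 hll)⟩

/-- Proposition `lamu13`: for continuous targets and `0 < K < π²/4`
there is `γ*` such that for every `γ > γ*` and every fixed continuous design `α` the
reduced system (state equations, adjoint equations, and `hᵢ = −(1/γ)∫₀¹ λᵢ Dm(α+ϑᵢ)`)
has a unique solution `(h, ϑ, λ) ∈ D × H^1_{0L}(I)ⁿ × H^1_{0L}(I)ⁿ`. -/
theorem reduced_system_exists_unique (n : ℕ)
    (tb : Fin n → ℝ → ℝ) (htb : ∀ i, ContinuousOn (tb i) (Icc (0:ℝ) 1))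
    (K : ℝ) (hK0 : 0 < K) (hK : K < Real.pi ^ 2 / 4) :
    ∃ γs : ℝ, 0 < γs ∧ ∀ γ : ℝ, γs < γ →
      ∀ α : ℝ → ℝ, ContinuousOn α (Icc (0:ℝ) 1) →
        ∃ (h : Fin n → ℝ × ℝ) (th l : Fin n → E),
          -- `h ∈ D`:
          (∀ i, enorm2 (h i) ≤ K) ∧
          -- the state equations:
          (∀ i, IsStateSolF α (h i) (th i)) ∧
          -- the adjoint equations:
          (∀ i, IsAdjSolF α (h i) (th i) (tb i) (l i)) ∧
          -- the control equations `hᵢ = −(1/γ)∫₀¹ λᵢ Dm(α+ϑᵢ)`: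
          (∀ i, h i = Tval γ α (th i) (l i)) ∧
          -- uniqueness within `D × H^1_{0L}(I)ⁿ × H^1_{0L}(I)ⁿ`:
          (∀ (h' : Fin n → ℝ × ℝ) (th' l' : Fin n → E),
            (∀ i, enorm2 (h' i) ≤ K) →
            (∀ i, IsStateSolF α (h' i) (th' i)) →
            (∀ i, IsAdjSolF α (h' i) (th' i) (tb i) (l' i)) →
            (∀ i, h' i = Tval γ α (th' i) (l' i)) →
            h' = h ∧ th' = th ∧ l' = l) := by
  have hκ : (2 / Real.pi) ^ 2 * K < 1 := by
    rw [div_pow, div_mul_eq_mul_div, div_lt_one (by positivity)]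
    linarith
  choose M hM using fun i => isCompact_Icc.exists_bound_of_continuousOn (htb i)
  have hmeas : ∀ f : ℝ → ℝ, ContinuousOn f (Icc (0:ℝ) 1) → AEStronglyMeasurable f mu01 :=
    fun f hf => (hf.mono Ioo_subset_Icc_self).aestronglyMeasurable measurableSet_Ioo
  have hMi : ∀ i, ∀ᵐ s ∂mu01, |tb i s| ≤ ∑ j, |M j| := fun i => by
    filter_upwards [ae_restrict_mem (measurableSet_Ioo (a := (0:ℝ)) (b := 1))] with s hs
    exact ((hM i s (Ioo_subset_Icc_self hs)).trans (le_abs_self _)).trans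
      (Finset.single_le_sum (fun j _ => abs_nonneg (M j)) (Finset.mem_univ i))
  obtain ⟨γs, hγs, H⟩ := exists_unique_single (M := ∑ j, |M j|) hK0 hκ
    (Finset.sum_nonneg fun j _ => abs_nonneg _)
  refine ⟨γs, hγs, fun γ hγ α hα => ?_⟩
  choose h th l hD hst hadj hT huniq using fun i =>
    H γ hγ α (tb i) (hmeas α hα) (hmeas _ (htb i)) (hMi i)
  refine ⟨h, th, l, hD, hst, hadj, hT, fun h' th' l' hD' hst' hadj' hT' => ?_⟩
  have hall := fun i => huniq i (h' i) (th' i) (l' i) (hD' i) (hst' i) (hadj' i) (hT' i)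
  exact ⟨funext fun i => (hall i).1, funext fun i => (hall i).2.1, funext fun i => (hall i).2.2⟩
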